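/- Let |v| < 1 and let m ≥ 1 be an integer. The map Q̃_v : ℝ → S² given by Q̃_v(x) = (√(1−v²) cos(mx), √(1−v²) sin(mx), −v) is a distributional solution of the traveling-wave equation Q̃_v × |∇|Q̃_v + v ∂_x Q̃_v = 0, and hence u(t,x) = Q̃_v(x − vt) is a traveling wave for the half-wave maps equation; moreover Q̃_v has infinite energy, i.e. ∬_{ℝ×ℝ} |Q̃_v(x) − Q̃_v(y)|²/(x − y)² dx dy = +∞. -/

import Mathlib

/-!
Infinite-energy traveling waves `Q̃_v(x) = (√(1-v²) cos(mx), √(1-v²) sin(mx), −v)`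
for the half-wave maps equation.
-/

open MeasureTheory Filter
open scoped ENNReal Topology

noncomputable section

/-- Vectors in ℝ³. -/
abbrev V3 : Type := Fin 3 → ℝ

/-- Cross product on ℝ³. -/
def cross3 (a b : V3) : V3 := crossProduct a b

/-- `HasHalfLap u g` means that `g = |∇|u` pointwise, where `|∇|` (the Fourier
multiplier with symbol `|ξ|`) is realized as the principal-value singular integral
`|∇|u(x) = (1/π) p.v. ∫ (u(x)-u(y))/(x-y)² dy`. -/
def HasHalfLap {E : Type*} [NormedAddCommGroup E] [NormedSpace ℝ E]
    (u g : ℝ → E) : Prop :=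
  ∀ x : ℝ, Filter.Tendsto
    (fun ε : ℝ =>
      (Real.pi)⁻¹ • ∫ y in {y : ℝ | ε ≤ |x - y|}, ((x - y) ^ 2)⁻¹ • (u x - u y))
    (nhdsWithin 0 (Set.Ioi 0)) (nhds (g x))

/-- The helical profile `Q̃_v(x) = (√(1-v²) cos(mx), √(1-v²) sin(mx), −v)`. -/
def helicalProfile (v : ℝ) (m : ℕ) (x : ℝ) : V3 :=
  ![Real.sqrt (1 - v ^ 2) * Real.cos (m * x),
    Real.sqrt (1 - v ^ 2) * Real.sin (m * x),
    -v]

lemma one_sub_cos_nonneg (x : ℝ) : 0 ≤ 1 - Real.cos x := sub_nonneg.2 (Real.cos_le_one x)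

lemma hasHalfLap_iff {E : Type*} [NormedAddCommGroup E] [NormedSpace ℝ E] {u g : ℝ → E} :
    HasHalfLap u g ↔ ∀ x : ℝ, Tendsto
      (fun ε : ℝ => (Real.pi)⁻¹ • ∫ h in {h : ℝ | ε ≤ |h|}, (h ^ 2)⁻¹ • (u x - u (x - h)))
      (𝓝[>] 0) (𝓝 (g x)) := by
  have key : ∀ x ε : ℝ, ∫ y in {y : ℝ | ε ≤ |x - y|}, ((x - y) ^ 2)⁻¹ • (u x - u y) =
      ∫ h in {h : ℝ | ε ≤ |h|}, (h ^ 2)⁻¹ • (u x - u (x - h)) := by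
    intro x ε
    rw [← integral_indicator (measurableSet_le measurable_const (by fun_prop)),
      ← integral_indicator (measurableSet_le measurable_const (by fun_prop)),
      ← integral_sub_left_eq_self _ volume x]
    congr 1
    ext y
    simp [Set.indicator]
  simp only [HasHalfLap, key]

lemma HasHalfLap.comp_sub_right {E : Type*} [NormedAddCommGroup E] [NormedSpace ℝ E]
    {u g : ℝ → E} (h : HasHalfLap u g) (a : ℝ) :
    HasHalfLap (fun x => u (x - a)) (fun x => g (x - a)) := by
  rw [hasHalfLap_iff] at h ⊢
  intro x
  simpa only [sub_right_comm x _ a] using h (x - a)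

lemma lintegral_Ioi_mul_exp_neg_mul {h : ℝ} (hh : 0 < h) :
    ∫⁻ s in Set.Ioi (0 : ℝ), ENNReal.ofReal (s * Real.exp (-(s * h))) =
      ENNReal.ofReal (1 / h ^ 2) := by
  have hd : ∀ s ∈ Set.Ici (0 : ℝ), HasDerivAt
      (fun s => -(s * h + 1) * Real.exp (-(s * h)) / h ^ 2) (s * Real.exp (-(s * h))) s := by
    intro s _
    have h1 : HasDerivAt (fun s : ℝ => s * h) h s := by
      simpa using (hasDerivAt_id s).mul_const h
    refine (((h1.add_const 1).fun_neg.fun_mul h1.fun_neg.exp).div_const (h ^ 2)).congr_deriv ?_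
    field_simp
    ring
  have hpos : ∀ s ∈ Set.Ioi (0 : ℝ), 0 ≤ s * Real.exp (-(s * h)) := fun s hs =>
    mul_nonneg (le_of_lt hs) (Real.exp_pos _).le
  have hlim : Tendsto (fun s => -(s * h + 1) * Real.exp (-(s * h)) / h ^ 2) atTop (𝓝 0) := by
    have h1 : Tendsto (fun s : ℝ => s * h) atTop atTop := tendsto_id.atTop_mul_const hh
    have h2 : Tendsto (fun t : ℝ => -(t + 1) * Real.exp (-t) / h ^ 2) atTop (𝓝 0) := by
      have h3 := Real.tendsto_pow_mul_exp_neg_atTop_nhds_zero 1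
      have h4 := Real.tendsto_pow_mul_exp_neg_atTop_nhds_zero 0
      have h5 := ((h3.add h4).neg).div_const (h ^ 2)
      simp only [add_zero, neg_zero, zero_div] at h5
      refine h5.congr fun t => ?_
      ring
    exact h2.comp h1
  rw [← ofReal_integral_eq_lintegral_ofReal (integrableOn_Ioi_deriv_of_nonneg' hd hpos hlim)
    ((ae_restrict_iff' measurableSet_Ioi).2 (ae_of_all _ hpos)),
    integral_Ioi_of_hasDerivAt_of_nonneg' hd hpos hlim]
  simp [neg_div]

lemma lintegral_Ioi_one_sub_cos_mul_exp_neg_mul {s : ℝ} (hs : 0 < s) :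
    ∫⁻ h in Set.Ioi (0 : ℝ), ENNReal.ofReal ((1 - Real.cos h) * Real.exp (-(s * h))) =
      ENNReal.ofReal (1 / (s * (1 + s ^ 2))) := by
  have hs2 : 1 + s ^ 2 ≠ 0 := by positivity
  have hd : ∀ h ∈ Set.Ici (0 : ℝ), HasDerivAt
      (fun h => (-1 / s - (Real.sin h - s * Real.cos h) / (1 + s ^ 2)) * Real.exp (-(s * h)))
      ((1 - Real.cos h) * Real.exp (-(s * h))) h := by
    intro h _
    have h1 : HasDerivAt (fun h : ℝ => s * h) s h := by
      simpa using (hasDerivAt_id h).const_mul s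
    refine (((((Real.hasDerivAt_sin h).fun_sub ((Real.hasDerivAt_cos h).const_mul s)).div_const
      (1 + s ^ 2)).const_sub (-1 / s)).fun_mul h1.fun_neg.exp).congr_deriv ?_
    field_simp
    ring
  have hpos : ∀ h ∈ Set.Ioi (0 : ℝ), 0 ≤ (1 - Real.cos h) * Real.exp (-(s * h)) := fun h _ =>
    mul_nonneg (one_sub_cos_nonneg h) (Real.exp_pos _).le
  have hlim : Tendsto
      (fun h => (-1 / s - (Real.sin h - s * Real.cos h) / (1 + s ^ 2)) * Real.exp (-(s * h)))
      atTop (𝓝 0) := by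
    have h1 : Tendsto (fun h : ℝ => Real.exp (-(s * h))) atTop (𝓝 0) :=
      Real.tendsto_exp_neg_atTop_nhds_zero.comp (tendsto_id.const_mul_atTop hs)
    refine bdd_le_mul_tendsto_zero' (1 / s + (1 + s) / (1 + s ^ 2)) (.of_forall fun h => ?_) h1
    have e1 : |Real.sin h - s * Real.cos h| ≤ 1 + s := by
      refine (abs_sub _ _).trans (add_le_add (Real.abs_sin_le_one h) ?_)
      rw [abs_mul, abs_of_pos hs]
      exact mul_le_of_le_one_right hs.le (Real.abs_cos_le_one h)
    refine (abs_sub _ _).trans (add_le_add ?_ ?_)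
    · rw [neg_div, abs_neg, abs_of_pos (by positivity)]
    · rw [abs_div, abs_of_pos (show 0 < 1 + s ^ 2 by positivity)]
      gcongr
  rw [← ofReal_integral_eq_lintegral_ofReal (integrableOn_Ioi_deriv_of_nonneg' hd hpos hlim)
    ((ae_restrict_iff' measurableSet_Ioi).2 (ae_of_all _ hpos)),
    integral_Ioi_of_hasDerivAt_of_nonneg' hd hpos hlim]
  congr 1
  simp
  field_simp
  ring

lemma lintegral_Ioi_one_sub_cos_div_sq :
    ∫⁻ h in Set.Ioi (0 : ℝ), ENNReal.ofReal ((1 - Real.cos h) / h ^ 2) =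
      ENNReal.ofReal (Real.pi / 2) := by
  calc ∫⁻ h in Set.Ioi (0 : ℝ), ENNReal.ofReal ((1 - Real.cos h) / h ^ 2)
      = ∫⁻ h in Set.Ioi (0 : ℝ), ∫⁻ s in Set.Ioi (0 : ℝ),
          ENNReal.ofReal ((1 - Real.cos h) * (s * Real.exp (-(s * h)))) := by
        refine setLIntegral_congr_fun measurableSet_Ioi fun h hh => ?_
        simp only [ENNReal.ofReal_mul (one_sub_cos_nonneg h)]
        rw [lintegral_const_mul _ (by fun_prop), lintegral_Ioi_mul_exp_neg_mul hh,
          ← ENNReal.ofReal_mul (one_sub_cos_nonneg h), mul_one_div]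
    _ = ∫⁻ s in Set.Ioi (0 : ℝ), ∫⁻ h in Set.Ioi (0 : ℝ),
          ENNReal.ofReal ((1 - Real.cos h) * (s * Real.exp (-(s * h)))) :=
        lintegral_lintegral_swap (by fun_prop)
    _ = ∫⁻ s in Set.Ioi (0 : ℝ), ENNReal.ofReal ((1 + s ^ 2)⁻¹) := by
        refine setLIntegral_congr_fun measurableSet_Ioi fun s hs => ?_
        have hs' : 0 < s := hs
        simp only [mul_left_comm _ s, ENNReal.ofReal_mul hs'.le]
        rw [lintegral_const_mul _ (by fun_prop), lintegral_Ioi_one_sub_cos_mul_exp_neg_mul hs,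
          ← ENNReal.ofReal_mul hs'.le]
        congr 1
        field_simp
    _ = ENNReal.ofReal (Real.pi / 2) := by
        rw [← ofReal_integral_eq_lintegral_ofReal integrable_inv_one_add_sq.integrableOn
          (ae_of_all _ fun s => by positivity), integral_Ioi_inv_one_add_sq]
        simp

lemma integrable_one_sub_cos_div_sq :
    Integrable (fun h : ℝ => (1 - Real.cos h) / h ^ 2) := by
  refine (integrable_inv_one_add_sq.const_mul 3).mono'
    (Measurable.aestronglyMeasurable (by fun_prop)) (ae_of_all _ fun h => ?_)
  rw [Real.norm_of_nonneg (div_nonneg (one_sub_cos_nonneg h) (sq_nonneg h))]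
  rcases eq_or_ne h 0 with rfl | h0
  · simp
  have hp : 0 < h ^ 2 := by positivity
  rw [← div_eq_mul_inv, div_le_div_iff₀ hp (by positivity)]
  nlinarith [Real.one_sub_sq_div_two_le_cos (x := h), Real.neg_one_le_cos h]

lemma integral_one_sub_cos_div_sq :
    ∫ h : ℝ, (1 - Real.cos h) / h ^ 2 = Real.pi := by
  have h1 := integral_comp_abs (f := fun h : ℝ => (1 - Real.cos h) / h ^ 2)
  simp only [Real.cos_abs, sq_abs] at h1
  rw [h1, integral_eq_lintegral_of_nonneg_ae
    (ae_of_all _ fun h => div_nonneg (one_sub_cos_nonneg h) (sq_nonneg h))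
    (Measurable.aestronglyMeasurable (by fun_prop)),
    lintegral_Ioi_one_sub_cos_div_sq, ENNReal.toReal_ofReal (by positivity)]
  ring

lemma integrable_one_sub_cos_mul_div_sq {k : ℝ} (hk : 0 < k) :
    Integrable (fun h : ℝ => (1 - Real.cos (k * h)) / h ^ 2) := by
  refine ((integrable_one_sub_cos_div_sq.comp_mul_left' hk.ne').const_mul (k ^ 2)).congr
    (ae_of_all _ fun h => ?_)
  simp only [mul_pow]
  field_simp

lemma integral_one_sub_cos_mul_div_sq {k : ℝ} (hk : 0 < k) :
    ∫ h : ℝ, (1 - Real.cos (k * h)) / h ^ 2 = Real.pi * k := by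
  have h1 := Measure.integral_comp_mul_left (fun h : ℝ => (1 - Real.cos h) / h ^ 2) k
  rw [integral_one_sub_cos_div_sq, abs_of_pos (inv_pos.2 hk), smul_eq_mul] at h1
  calc ∫ h : ℝ, (1 - Real.cos (k * h)) / h ^ 2
      = ∫ h : ℝ, k ^ 2 * ((1 - Real.cos (k * h)) / (k * h) ^ 2) := by
        congr 1
        ext h
        simp only [mul_pow]
        field_simp
    _ = Real.pi * k := by
        rw [integral_const_mul, h1]
        field_simp

lemma tendsto_setIntegral_le_abs {f : ℝ → ℝ} (hf : Integrable f) :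
    Tendsto (fun ε : ℝ => ∫ h in {h : ℝ | ε ≤ |h|}, f h) (𝓝[>] 0) (𝓝 (∫ h, f h)) := by
  have hm : ∀ ε : ℝ, MeasurableSet {h : ℝ | ε ≤ |h|} := fun ε =>
    measurableSet_le measurable_const (by fun_prop)
  simp only [← fun ε => integral_indicator (f := f) (μ := volume) (hm ε)]
  refine tendsto_integral_filter_of_dominated_convergence (fun h => ‖f h‖)
    (.of_forall fun ε => hf.aestronglyMeasurable.indicator (hm ε))
    (.of_forall fun ε => ae_of_all _ fun h => norm_indicator_le_norm_self _ _) hf.norm ?_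
  filter_upwards [compl_mem_ae_iff.2 (measure_singleton (0 : ℝ))] with h h0
  refine tendsto_const_nhds.congr' ?_
  have h0' : 0 < |h| := abs_pos.2 h0
  filter_upwards [nhdsWithin_le_nhds (Iio_mem_nhds h0')] with ε hε
  exact (Set.indicator_of_mem (show h ∈ {h : ℝ | ε ≤ |h|} from (Set.mem_Iio.1 hε).le) f).symm

lemma integrableOn_sin_mul_div_sq (k : ℝ) {ε : ℝ} (hε : 0 < ε) :
    IntegrableOn (fun h : ℝ => Real.sin (k * h) / h ^ 2) {h : ℝ | ε ≤ |h|} := by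
  refine (integrable_inv_one_add_sq.const_mul (1 + (ε ^ 2)⁻¹)).integrableOn.mono'
    (Measurable.aestronglyMeasurable (by fun_prop))
    ((ae_restrict_iff' (measurableSet_le measurable_const (by fun_prop))).2
      (ae_of_all _ fun h hh => ?_))
  have h1 : ε ^ 2 ≤ h ^ 2 := by
    rw [← sq_abs h]
    exact pow_le_pow_left₀ hε.le hh 2
  have hp : 0 < h ^ 2 := lt_of_lt_of_le (by positivity) h1
  have h2 : 1 ≤ (ε ^ 2)⁻¹ * h ^ 2 := by
    rw [inv_mul_eq_div]
    exact (one_le_div (by positivity)).2 h1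
  rw [Real.norm_eq_abs, abs_div, abs_of_pos hp, ← div_eq_mul_inv,
    div_le_div_iff₀ hp (by positivity)]
  calc |Real.sin (k * h)| * (1 + h ^ 2) ≤ 1 * (1 + h ^ 2) := by
        gcongr
        exact Real.abs_sin_le_one _
    _ ≤ (1 + (ε ^ 2)⁻¹) * h ^ 2 := by linarith

lemma setIntegral_sin_mul_div_sq (k ε : ℝ) :
    ∫ h in {h : ℝ | ε ≤ |h|}, Real.sin (k * h) / h ^ 2 = 0 := by
  rw [← integral_indicator (measurableSet_le measurable_const (by fun_prop))]
  refine self_eq_neg.1 ?_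
  rw [← integral_neg, ← integral_neg_eq_self]
  congr 1
  ext h
  simp only [Set.indicator, Set.mem_ofPred_eq, abs_neg, mul_neg, Real.sin_neg, neg_sq, neg_div]
  split_ifs <;> simp

/-- The half-Laplacian `m (√(1-v²) cos(mx), √(1-v²) sin(mx), 0)` of the helical profile. -/
def helicalHalfLap (v : ℝ) (m : ℕ) (x : ℝ) : V3 :=
  ![m * (Real.sqrt (1 - v ^ 2) * Real.cos (m * x)),
    m * (Real.sqrt (1 - v ^ 2) * Real.sin (m * x)),
    0]

/-- The derivative of the helical profile. -/
def helicalDeriv (v : ℝ) (m : ℕ) (x : ℝ) : V3 :=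
  ![-(m * (Real.sqrt (1 - v ^ 2) * Real.sin (m * x))),
    m * (Real.sqrt (1 - v ^ 2) * Real.cos (m * x)),
    0]

lemma hasDerivAt_helicalProfile (v : ℝ) (m : ℕ) (x : ℝ) :
    HasDerivAt (helicalProfile v m) (helicalDeriv v m x) x := by
  have h1 : HasDerivAt (fun x : ℝ => (m : ℝ) * x) m x := by
    simpa using (hasDerivAt_id x).const_mul (m : ℝ)
  rw [hasDerivAt_pi]
  intro i
  fin_cases i
  · refine (h1.cos.const_mul (Real.sqrt (1 - v ^ 2))).congr_deriv ?_
    simp [helicalDeriv]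
    ring
  · refine (h1.sin.const_mul (Real.sqrt (1 - v ^ 2))).congr_deriv ?_
    simp [helicalDeriv]
    ring
  · simpa [helicalProfile, helicalDeriv] using hasDerivAt_const x (-v)

lemma cross3_helicalProfile (v : ℝ) (m : ℕ) (x : ℝ) :
    cross3 (helicalProfile v m x) (helicalHalfLap v m x) = (-v) • helicalDeriv v m x := by
  ext i
  fin_cases i <;>
    (simp [cross3, cross_apply, helicalProfile, helicalHalfLap, helicalDeriv]; try ring)

lemma helicalProfile_sub (v : ℝ) {m : ℕ} (hm : 1 ≤ m) (x h : ℝ) :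
    (h ^ 2)⁻¹ • (helicalProfile v m x - helicalProfile v m (x - h)) =
      ((1 - Real.cos (m * h)) / h ^ 2) • ((m : ℝ)⁻¹ • helicalHalfLap v m x) +
        (Real.sin (m * h) / h ^ 2) • ((m : ℝ)⁻¹ • helicalDeriv v m x) := by
  have hm0 : (m : ℝ) ≠ 0 := by positivity
  ext i
  fin_cases i <;>
    simp [helicalProfile, helicalHalfLap, helicalDeriv, mul_sub, Real.cos_sub, Real.sin_sub,
      hm0] <;> ring

lemma hasHalfLap_helicalProfile (v : ℝ) {m : ℕ} (hm : 1 ≤ m) :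
    HasHalfLap (helicalProfile v m) (helicalHalfLap v m) := by
  have hm0 : (0 : ℝ) < m := by positivity
  rw [hasHalfLap_iff]
  intro x
  have h1 := ((tendsto_setIntegral_le_abs (integrable_one_sub_cos_mul_div_sq hm0)).smul_const
    ((m : ℝ)⁻¹ • helicalHalfLap v m x)).const_smul Real.pi⁻¹
  have h2 : Real.pi⁻¹ • (∫ h : ℝ, (1 - Real.cos (m * h)) / h ^ 2) •
      ((m : ℝ)⁻¹ • helicalHalfLap v m x) = helicalHalfLap v m x := by
    rw [integral_one_sub_cos_mul_div_sq hm0, smul_smul, smul_smul]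
    convert one_smul ℝ (helicalHalfLap v m x)
    field_simp
  rw [h2] at h1
  refine h1.congr' ?_
  filter_upwards [self_mem_nhdsWithin] with ε hε
  simp only [helicalProfile_sub v hm]
  rw [integral_add ((integrable_one_sub_cos_mul_div_sq hm0).integrableOn.smul_const _)
    ((integrableOn_sin_mul_div_sq m hε).smul_const _), integral_smul_const, integral_smul_const,
    setIntegral_sin_mul_div_sq, zero_smul, add_zero]

lemma sum_sq_helicalProfile_sub {v : ℝ} (hv : |v| < 1) (m : ℕ) (x y : ℝ) :
    ∑ i, (helicalProfile v m x i - helicalProfile v m y i) ^ 2 =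
      2 * (1 - v ^ 2) * (1 - Real.cos (m * (x - y))) := by
  have hA : Real.sqrt (1 - v ^ 2) ^ 2 = 1 - v ^ 2 :=
    Real.sq_sqrt (sub_nonneg.2 ((sq_lt_one_iff_abs_lt_one v).2 hv).le)
  have hx := Real.sin_sq_add_cos_sq (m * x)
  have hy := Real.sin_sq_add_cos_sq (m * y)
  simp only [Fin.sum_univ_three, helicalProfile, mul_sub (m : ℝ), Real.cos_sub]
  simp only [Matrix.cons_val]
  linear_combination (2 - 2 * (Real.cos (m * x) * Real.cos (m * y) +
    Real.sin (m * x) * Real.sin (m * y))) * hA +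
    Real.sqrt (1 - v ^ 2) ^ 2 * (hx + hy)

lemma lintegral_energy_density_helicalProfile {v : ℝ} (hv : |v| < 1) {m : ℕ} (hm : 1 ≤ m)
    (x : ℝ) :
    ∫⁻ y : ℝ, ENNReal.ofReal
        ((∑ i, (helicalProfile v m x i - helicalProfile v m y i) ^ 2) / (x - y) ^ 2) =
      ENNReal.ofReal (2 * (1 - v ^ 2) * (Real.pi * m)) := by
  have hm0 : (0 : ℝ) < m := by positivity
  have hA : 0 < 1 - v ^ 2 := sub_pos.2 ((sq_lt_one_iff_abs_lt_one v).2 hv)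
  simp only [sum_sq_helicalProfile_sub hv, mul_div_assoc]
  rw [lintegral_sub_left_eq_self (fun h : ℝ => ENNReal.ofReal
      (2 * (1 - v ^ 2) * ((1 - Real.cos (m * h)) / h ^ 2))) x,
    ← ofReal_integral_eq_lintegral_ofReal
      ((integrable_one_sub_cos_mul_div_sq hm0).const_mul _)
      (ae_of_all _ fun h => mul_nonneg (by positivity)
        (div_nonneg (one_sub_cos_nonneg _) (sq_nonneg h))),
    integral_const_mul, integral_one_sub_cos_mul_div_sq hm0]

/-- **Infinite-energy traveling waves.**  For `|v| < 1` and an integer `m ≥ 1`, the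
sphere-valued map `Q̃_v(x) = (√(1-v²) cos(mx), √(1-v²) sin(mx), −v)` solves the
traveling-wave equation `Q̃_v × |∇|Q̃_v + v ∂ₓQ̃_v = 0`; hence
`u(t,x) = Q̃_v(x - vt)` is a traveling wave for the half-wave maps equation
`∂ₜu = u × |∇|u`.  Moreover, `Q̃_v` has infinite energy:
`∬ |Q̃_v(x) - Q̃_v(y)|²/(x-y)² dx dy = +∞`. -/
theorem helical_infinite_energy_traveling_wave
    (v : ℝ) (hv : |v| < 1) (m : ℕ) (hm : 1 ≤ m) :
    (∃ G : ℝ → V3, HasHalfLap (helicalProfile v m) G ∧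
      (∀ x : ℝ,
        cross3 (helicalProfile v m x) (G x) + v • deriv (helicalProfile v m) x = 0) ∧
      (∀ t : ℝ,
        HasHalfLap (fun x => helicalProfile v m (x - v * t))
            (fun x => G (x - v * t)) ∧
        ∀ x : ℝ,
          HasDerivAt (fun s => helicalProfile v m (x - v * s))
            (cross3 (helicalProfile v m (x - v * t)) (G (x - v * t))) t)) ∧
    (∫⁻ x : ℝ, ∫⁻ y : ℝ,
        ENNReal.ofReal
          ((∑ i, (helicalProfile v m x i - helicalProfile v m y i) ^ 2) /
            (x - y) ^ 2)) = ⊤ := by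
  have hA : 0 < 1 - v ^ 2 := sub_pos.2 ((sq_lt_one_iff_abs_lt_one v).2 hv)
  refine ⟨⟨helicalHalfLap v m, hasHalfLap_helicalProfile v hm, fun x => ?_, fun t =>
    ⟨(hasHalfLap_helicalProfile v hm).comp_sub_right _, fun x => ?_⟩⟩, ?_⟩
  · rw [cross3_helicalProfile, (hasDerivAt_helicalProfile v m x).deriv, neg_smul, neg_add_cancel]
  · rw [cross3_helicalProfile]
    refine (hasDerivAt_helicalProfile v m (x - v * t)).scomp (h := fun s => x - v * s) t ?_
    simpa using ((hasDerivAt_id t).const_mul v).const_sub x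
  · simp only [lintegral_energy_density_helicalProfile hv hm, lintegral_const, Real.volume_univ]
    exact ENNReal.mul_top (by positivity)
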